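/- Let A be a commutative ring, F an n×n matrix over A with F² = F, and k an integer with 0 ≤ k ≤ n. If every coefficient of the polynomial det(X·I_n − F) − X^{n−k}(X−1)^k is nilpotent in A, then in fact det(X·I_n − F) = X^{n−k}(X−1)^k exactly, and moreover every (k+1)×(k+1) minor of F is zero. -/

import Mathlib

open Polynomial Matrix

/-- An idempotent matrix over a local ring factors through a free module. -/
theorem idem_local_factor {R : Type*} [CommRing R] [IsLocalRing R] {n : ℕ}
    (F : Matrix (Fin n) (Fin n) R) (hF : F * F = F) :
    ∃ (r : ℕ) (B : Matrix (Fin n) (Fin r) R) (D : Matrix (Fin r) (Fin n) R),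
      B * D = F ∧ D * B = 1 := by
  let f := Matrix.toLin' F
  have hff : ∀ x, f (f x) = f x := by
    intro x
    have : (f ∘ₗ f) = f := by
      simp only [f]
      rw [← Matrix.toLin'_mul, hF]
    exact LinearMap.congr_fun this x
  have hid : f.rangeRestrict ∘ₗ (LinearMap.range f).subtype = LinearMap.id := by
    apply LinearMap.ext
    rintro ⟨_, y, rfl⟩
    apply Subtype.ext
    exact hff y
  have hproj : Module.Projective R (LinearMap.range f) :=
    Module.Projective.of_split _ _ hid
  have hfree : Module.Free R (LinearMap.range f) := Module.free_of_flat_of_isLocalRing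
  let b := Module.finBasis R (LinearMap.range f)
  refine ⟨_, LinearMap.toMatrix b (Pi.basisFun R (Fin n)) (LinearMap.range f).subtype,
    LinearMap.toMatrix (Pi.basisFun R (Fin n)) b f.rangeRestrict, ?_, ?_⟩
  · rw [← LinearMap.toMatrix_comp]
    have : (LinearMap.range f).subtype ∘ₗ f.rangeRestrict = f := by
      ext x; rfl
    rw [this, LinearMap.toMatrix_eq_toMatrix']
    simp [f]
  · rw [← LinearMap.toMatrix_comp, hid, LinearMap.toMatrix_id]

theorem det_mul_eq_zero_of_thin {R : Type*} [CommRing R] {k : ℕ}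
    (B : Matrix (Fin (k + 1)) (Fin k) R) (D : Matrix (Fin k) (Fin (k + 1)) R) :
    (B * D).det = 0 := by
  have : B * D = (Matrix.of fun i j => Fin.cases (motive := fun _ => R) 0 (fun j => B i j) j) *
      (Matrix.of fun i j => Fin.cases (motive := fun _ => R) 0 (fun i => D i j) i) := by
    ext i j
    simp [Matrix.mul_apply, Fin.sum_univ_succ]
  rw [this, Matrix.det_mul, Matrix.det_eq_zero_of_column_eq_zero 0 (by simp), zero_mul]

theorem rank_unique {K : Type*} [Field K] (a b c d : ℕ)
    (h : (X : K[X]) ^ a * (X - 1) ^ b = X ^ c * (X - 1) ^ d) : b = d := by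
  have key : ∀ a b : ℕ, rootMultiplicity (1 : K) ((X : K[X]) ^ a * (X - 1) ^ b) = b := by
    intro a b
    have h1 : ((X : K[X]) - 1) = X - C 1 := by simp
    rw [h1, rootMultiplicity_mul, rootMultiplicity_X_sub_C_pow, rootMultiplicity_eq_zero, zero_add]
    · simp
    · exact mul_ne_zero (pow_ne_zero _ X_ne_zero) (pow_ne_zero _ (X_sub_C_ne_zero _))
  rw [← key a b, h, key]

theorem idem_local_case {R : Type*} [CommRing R] [IsLocalRing R] {n : ℕ}
    (F : Matrix (Fin n) (Fin n) R) (hF : F * F = F)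
    (k : ℕ) (hk : k ≤ n)
    (hnil : ∀ i : ℕ, IsNilpotent
      ((F.charpoly - Polynomial.X ^ (n - k) * (Polynomial.X - 1) ^ k).coeff i)) :
    F.charpoly = Polynomial.X ^ (n - k) * (Polynomial.X - 1) ^ k ∧
      ∀ (ri ci : Fin (k + 1) → Fin n), (F.submatrix ri ci).det = 0 := by
  obtain ⟨r, B, D, hBD, hDB⟩ := idem_local_factor F hF
  have h1 : X ^ r * F.charpoly = X ^ n * (X - 1) ^ r := by
    have := Matrix.charpoly_mul_comm' B D
    rw [hBD, hDB, Matrix.charpoly_one] at this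
    simpa using this
  have h2 : F.charpoly.map (IsLocalRing.residue R) = X ^ (n - k) * (X - 1) ^ k := by
    rw [← sub_eq_zero]
    ext i
    have := ((hnil i).map (IsLocalRing.residue R)).eq_zero
    rw [← Polynomial.coeff_map] at this
    simpa using this
  have hr : k = r := by
    have := congrArg (Polynomial.map (IsLocalRing.residue R)) h1
    rw [Polynomial.map_mul, h2, ← mul_assoc] at this
    simp only [Polynomial.map_mul, Polynomial.map_pow, Polynomial.map_sub, Polynomial.map_X,
      Polynomial.map_one, ← pow_add] at this
    exact rank_unique _ _ _ _ this
  subst hr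
  refine ⟨?_, fun ri ci => ?_⟩
  · apply (isRegular_X_pow k).left.eq_iff.mp
    rw [h1, ← mul_assoc, ← pow_add, Nat.add_sub_cancel' hk]
  · have : F.submatrix ri ci = B.submatrix ri id * D.submatrix id ci := by
      rw [← hBD, Matrix.submatrix_mul _ _ _ _ _ Function.bijective_id]
    rw [this, det_mul_eq_zero_of_thin]

/-- **Theorem 5.** Let `F` be an idempotent `n × n` matrix over a commutative ring `A`
and `0 ≤ k ≤ n`.  If the characteristic polynomial of `F` equals
`X ^ (n - k) * (X - 1) ^ k` up to nilpotent coefficients, then it equals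
`X ^ (n - k) * (X - 1) ^ k` exactly, and all `(k+1) × (k+1)` minors of `F` vanish. -/
theorem charpoly_eq_and_minors_eq_zero_of_charpoly_eq_up_to_nilpotents
    {A : Type*} [CommRing A] {n : ℕ}
    (F : Matrix (Fin n) (Fin n) A) (hF : F * F = F)
    (k : ℕ) (hk : k ≤ n)
    (hnil : ∀ i : ℕ, IsNilpotent
      ((F.charpoly - Polynomial.X ^ (n - k) * (Polynomial.X - 1) ^ k).coeff i)) :
    F.charpoly = Polynomial.X ^ (n - k) * (Polynomial.X - 1) ^ k ∧
      ∀ (ri ci : Fin (k + 1) → Fin n),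
        Function.Injective ri → Function.Injective ci →
        (F.submatrix ri ci).det = 0 := by

  have key : ∀ (J : Ideal A) (_ : J.IsMaximal),
      (F.charpoly - X ^ (n - k) * (X - 1) ^ k).map (algebraMap A (Localization.AtPrime J)) = 0 ∧
      ∀ (ri ci : Fin (k + 1) → Fin n),
        algebraMap A (Localization.AtPrime J) (F.submatrix ri ci).det = 0 := by
    intro J hJ
    let φ := algebraMap A (Localization.AtPrime J)
    have hmap : (F.map φ).charpoly - X ^ (n - k) * (X - 1) ^ k =
        (F.charpoly - X ^ (n - k) * (X - 1) ^ k).map φ := by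
      simp [Matrix.charpoly_map]
    have := idem_local_case (F.map φ) (by rw [← Matrix.map_mul, hF]) k hk (by
      intro i
      rw [hmap, Polynomial.coeff_map]
      exact (hnil i).map φ)
    refine ⟨?_, fun ri ci => ?_⟩
    · rw [← hmap, this.1, sub_self]
    · rw [RingHom.map_det]
      exact this.2 ri ci
  refine ⟨?_, fun ri ci _ _ => ?_⟩
  · rw [← sub_eq_zero]
    ext i
    rw [coeff_zero]
    apply eq_zero_of_localization
    intro J hJ
    rw [← Polynomial.coeff_map, (key J hJ).1, coeff_zero]
  · exact eq_zero_of_localization _ fun J hJ => (key J hJ).2 ri ci
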